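/- The series ∑_{k=0}^∞ C(4k,2k) · C(2k,k)^2 / (2^{8k} · 3^{2k}) · (8k+1) converges to 2√3/π (Ramanujan's formula for 1/π). -/

import Mathlib

open Filter Topology Finset

/-- The hypergeometric factor `(1/2)ₙ (1/4 + 3k/2)ₙ (3/4 + 3k/2)ₙ / (n! ((1 + k)ₙ)² 9ⁿ)`. -/
noncomputable def hypTerm (k n : ℕ) : ℝ :=
  ∏ j ∈ range n, (1 / 2 + j : ℝ) * (1 / 4 + 3 * k / 2 + j) * (3 / 4 + 3 * k / 2 + j) /
    (9 * (1 + j) * (1 + k + j) ^ 2)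

/-- The normalising factor `(1/6)ₖ (5/6)ₖ / (k!)²`. -/
noncomputable def hypFactor (k : ℕ) : ℝ :=
  ∏ j ∈ range k, (1 / 6 + j : ℝ) * (5 / 6 + j) / (1 + j) ^ 2

lemma hypTerm_zero (k : ℕ) : hypTerm k 0 = 1 := by simp [hypTerm]

lemma hypTerm_succ (k n : ℕ) : hypTerm k (n + 1) = hypTerm k n *
    ((1 / 2 + n : ℝ) * (1 / 4 + 3 * k / 2 + n) * (3 / 4 + 3 * k / 2 + n) /
      (9 * (1 + n) * (1 + k + n) ^ 2)) := by
  simp only [hypTerm, prod_range_succ]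

lemma hypFactor_zero : hypFactor 0 = 1 := by simp [hypFactor]

lemma hypFactor_succ (k : ℕ) :
    hypFactor (k + 1) = hypFactor k * ((1 / 6 + k : ℝ) * (5 / 6 + k) / (1 + k) ^ 2) := by
  simp only [hypFactor, prod_range_succ]

lemma hypTerm_nonneg (k n : ℕ) : 0 ≤ hypTerm k n :=
  prod_nonneg fun j _ => by positivity

lemma hypTerm_le (k n : ℕ) : hypTerm k n ≤ (1 / 4) ^ n := by
  induction n with
  | zero => simp [hypTerm_zero]
  | succ n ih =>
    rw [hypTerm_succ, pow_succ (1 / 4 : ℝ)]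
    refine mul_le_mul ih ?_ (by positivity) (by positivity)
    rw [div_le_iff₀ (by positivity)]
    have hn : (0 : ℝ) ≤ n := n.cast_nonneg
    have hk : (0 : ℝ) ≤ k := k.cast_nonneg
    calc (1 / 2 + n : ℝ) * (1 / 4 + 3 * k / 2 + n) * (3 / 4 + 3 * k / 2 + n)
        ≤ (1 + n) * (3 / 2 * (1 + k + n)) * (3 / 2 * (1 + k + n)) := by
          gcongr <;> linarith
      _ = 1 / 4 * (9 * (1 + n) * (1 + k + n) ^ 2) := by ring

lemma hypTerm_shift (k n : ℕ) : hypTerm (k + 1) n = hypTerm k n *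
    ((k + 1) ^ 2 * ((2 * n + 3 * k + 1 / 2) * (2 * n + 3 * k + 3 / 2) * (2 * n + 3 * k + 5 / 2)) /
      ((k + 1 + n) ^ 2 * ((3 * k + 1 / 2) * (3 * k + 3 / 2) * (3 * k + 5 / 2)))) := by
  induction n with
  | zero =>
    simp only [hypTerm_zero, Nat.cast_zero]
    field_simp
    ring
  | succ n ih =>
    rw [hypTerm_succ, hypTerm_succ, ih]
    push_cast
    field_simp
    ring

/-- The Wilf–Zeilberger pair identity, summed over `n < N`. -/
lemma sum_range_wz (k N : ℕ) :
    ∑ n ∈ range N, (hypFactor (k + 1) * hypTerm (k + 1) n * (8 * n + 6 * (k + 1 : ℕ) + 1) -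
      hypFactor k * hypTerm k n * (8 * n + 6 * k + 1)) =
    -(8 * N * (2 * N - 1) / (3 * (2 * k + 1))) * (hypFactor k * hypTerm k N) := by
  induction N with
  | zero => simp
  | succ N ih =>
    rw [sum_range_succ, ih, hypTerm_shift, hypTerm_succ, hypFactor_succ]
    push_cast
    field_simp
    ring

lemma tendsto_sq_mul_quarter_pow :
    Tendsto (fun n : ℕ => (n : ℝ) ^ 2 * (1 / 4) ^ n) atTop (𝓝 0) :=
  (summable_pow_mul_geometric_of_norm_lt_one 2 (by norm_num : ‖(1 / 4 : ℝ)‖ < 1)).tendsto_atTop_zero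

lemma summable_linear_mul_quarter_pow (a b : ℝ) :
    Summable fun n : ℕ => (1 / 4 : ℝ) ^ n * (a * n + b) := by
  have h (m : ℕ) := summable_pow_mul_geometric_of_norm_lt_one m
    (by norm_num : ‖(1 / 4 : ℝ)‖ < 1)
  refine (((h 1).mul_left a).add ((h 0).mul_left b)).congr fun n => ?_
  ring

lemma summable_hypTerm (k : ℕ) :
    Summable fun n : ℕ => hypFactor k * hypTerm k n * (8 * n + 6 * k + 1) := by
  have h : Summable fun n : ℕ => hypTerm k n * (8 * n + (6 * k + 1)) :=
    Summable.of_nonneg_of_le (fun n => mul_nonneg (hypTerm_nonneg k n) (by positivity))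
      (fun n => mul_le_mul_of_nonneg_right (hypTerm_le k n) (by positivity))
      (summable_linear_mul_quarter_pow 8 (6 * k + 1))
  refine (h.mul_left (hypFactor k)).congr fun n => ?_
  ring

lemma tsum_hypTerm_succ (k : ℕ) :
    ∑' n : ℕ, hypFactor (k + 1) * hypTerm (k + 1) n * (8 * n + 6 * (k + 1 : ℕ) + 1) =
      ∑' n : ℕ, hypFactor k * hypTerm k n * (8 * n + 6 * k + 1) := by
  rw [← sub_eq_zero, ← (summable_hypTerm (k + 1)).tsum_sub (summable_hypTerm k)]
  refine tendsto_nhds_unique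
    ((summable_hypTerm (k + 1)).sub (summable_hypTerm k)).hasSum.tendsto_sum_nat ?_
  simp_rw [sum_range_wz]
  rw [tendsto_zero_iff_abs_tendsto_zero]
  have hlim := tendsto_sq_mul_quarter_pow.const_mul (16 / (3 * (2 * k + 1)) * |hypFactor k|)
  rw [mul_zero] at hlim
  refine squeeze_zero (fun _ => abs_nonneg _) (fun N => ?_) hlim
  have h1 : |8 * (N : ℝ) * (2 * N - 1)| ≤ 16 * N ^ 2 := by
    rcases N with _ | N
    · simp
    · rw [abs_of_nonneg (by push_cast; nlinarith [N.cast_nonneg (α := ℝ)])]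
      push_cast
      nlinarith [N.cast_nonneg (α := ℝ)]
  simp only [Function.comp_apply]
  rw [abs_mul, abs_neg, abs_div, abs_mul (hypFactor k), abs_of_nonneg (hypTerm_nonneg k N),
    abs_of_pos (by positivity : (0 : ℝ) < 3 * (2 * k + 1))]
  calc |8 * (N : ℝ) * (2 * N - 1)| / (3 * (2 * k + 1)) * (|hypFactor k| * hypTerm k N)
      ≤ 16 * N ^ 2 / (3 * (2 * k + 1)) * (|hypFactor k| * (1 / 4) ^ N) := by
        gcongr
        · exact mul_nonneg (abs_nonneg _) (hypTerm_nonneg k N)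
        · exact hypTerm_le k N
    _ = _ := by ring

lemma tsum_hypTerm_eq (k : ℕ) :
    ∑' n : ℕ, hypFactor k * hypTerm k n * (8 * n + 6 * k + 1) =
      ∑' n : ℕ, hypFactor 0 * hypTerm 0 n * (8 * n + 6 * (0 : ℕ) + 1) := by
  induction k with
  | zero => rfl
  | succ k ih => rw [tsum_hypTerm_succ, ih]

lemma hypFactor_mul_eq (k : ℕ) : hypFactor k * (k + 1 / 6) =
    1 / Real.pi * (Real.pi * (1 / 6) *
      ∏ j ∈ range k, ((1 : ℝ) - (1 / 6) ^ 2 / ((j : ℝ) + 1) ^ 2)) := by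
  have hpi := Real.pi_ne_zero
  induction k with
  | zero =>
    simp only [hypFactor_zero, range_zero, prod_empty, Nat.cast_zero]
    field_simp
    ring
  | succ k ih =>
    have h : hypFactor (k + 1) * ((k + 1 : ℕ) + 1 / 6) = hypFactor k * (k + 1 / 6) *
        ((1 : ℝ) - (1 / 6) ^ 2 / ((k : ℝ) + 1) ^ 2) := by
      rw [hypFactor_succ]
      push_cast
      field_simp
      ring
    rw [h, ih, prod_range_succ]
    ring

lemma tendsto_hypFactor_mul :
    Tendsto (fun k : ℕ => hypFactor k * (k + 1 / 6)) atTop (𝓝 (1 / (2 * Real.pi))) := by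
  simp_rw [hypFactor_mul_eq]
  convert (Real.tendsto_euler_sin_prod (1 / 6)).const_mul (1 / Real.pi) using 2
  rw [mul_one_div, Real.sin_pi_div_six]
  ring

/-- The binomial series of `(1 - x) ^ (-1/2)` at `x = 1/4`. -/
lemma hasSum_binomial_quarter :
    HasSum (fun n : ℕ => ∏ j ∈ range n, (1 / 2 + j : ℝ) / (4 * (1 + j))) (2 / Real.sqrt 3) := by
  have h := (Real.one_div_one_sub_rpow_hasFPowerSeriesOnBall_zero (1 / 2)).hasSum
    (y := 1 / 4) (by
      rw [Metric.mem_eball, edist_dist, ← ENNReal.ofReal_one]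
      exact (ENNReal.ofReal_lt_ofReal_iff one_pos).2 (by norm_num))
  have hc (n : ℕ) : Ring.choose (1 / 2 + n - 1 : ℝ) n * (1 / 4) ^ n =
      ∏ j ∈ range n, (1 / 2 + j : ℝ) / (4 * (1 + j)) := by
    have hf := Ring.factorial_nsmul_multichoose_eq_ascPochhammer (1 / 2 : ℝ) n
    rw [Ring.multichoose_eq, Polynomial.ascPochhammer_smeval_eq_eval, nsmul_eq_mul] at hf
    have hn : (n.factorial : ℝ) ≠ 0 := by positivity
    rw [← mul_right_inj' hn, ← mul_assoc, hf]
    clear hf hn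
    induction n with
    | zero => simp
    | succ n ih =>
      rw [ascPochhammer_succ_eval, prod_range_succ, Nat.factorial_succ, pow_succ, Nat.cast_mul,
        mul_mul_mul_comm, ih]
      push_cast
      field_simp
      ring
  simp only [FormalMultilinearSeries.ofScalars_apply_eq, smul_eq_mul, hc, zero_add] at h
  have h4 : (1 - 1 / 4 : ℝ) = 3 / 2 ^ 2 := by norm_num
  rw [← Real.sqrt_eq_rpow, h4, Real.sqrt_div (by norm_num), Real.sqrt_sq (by norm_num),
    one_div_div] at h
  exact h

lemma tendsto_hypTerm (n : ℕ) : Tendsto (fun k : ℕ => hypTerm k n) atTop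
    (𝓝 (∏ j ∈ range n, (1 / 2 + j : ℝ) / (4 * (1 + j)))) := by
  refine tendsto_finsetProd _ fun j _ => ?_
  have h0 : Tendsto (fun k : ℕ => 1 / (k : ℝ)) atTop (𝓝 0) := tendsto_one_div_atTop_nhds_zero_nat
  have h : Tendsto (fun k : ℕ => (1 / 2 + j : ℝ) * ((1 / 4 + j) * (1 / (k : ℝ)) + 3 / 2) *
      ((3 / 4 + j) * (1 / (k : ℝ)) + 3 / 2) / (9 * (1 + j) * ((1 + j) * (1 / (k : ℝ)) + 1) ^ 2))
      atTop (𝓝 ((1 / 2 + j : ℝ) * ((1 / 4 + j) * 0 + 3 / 2) *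
      ((3 / 4 + j) * 0 + 3 / 2) / (9 * (1 + j) * ((1 + j) * 0 + 1) ^ 2))) := by
    refine Tendsto.div ?_ ?_ (by positivity)
    · exact (((h0.const_mul _).add_const _).const_mul _).mul ((h0.const_mul _).add_const _)
    · exact (((h0.const_mul _).add_const _).pow 2).const_mul _
  convert h.congr' ?_ using 2
  · field_simp
    ring
  · filter_upwards [eventually_gt_atTop 0] with k hk
    have hk : (0 : ℝ) < k := by exact_mod_cast hk
    field_simp
    ring

lemma tendsto_tsum_hypTerm :
    Tendsto (fun k : ℕ => ∑' n : ℕ, hypTerm k n * (8 * n / (k + 1 / 6) + 6)) atTop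
      (𝓝 (2 / Real.sqrt 3 * 6)) := by
  rw [← (hasSum_binomial_quarter.mul_right 6).tsum_eq]
  refine tendsto_tsum_of_dominated_convergence (summable_linear_mul_quarter_pow 48 6)
    (fun n => (tendsto_hypTerm n).mul ?_) (Eventually.of_forall fun k n => ?_)
  · have h : Tendsto (fun k : ℕ => (k : ℝ) + 1 / 6) atTop atTop :=
      tendsto_atTop_add_const_right _ _ tendsto_natCast_atTop_atTop
    simpa using (h.const_div_atTop (8 * (n : ℝ))).add_const 6
  · have hk : (0 : ℝ) ≤ k := k.cast_nonneg
    rw [Real.norm_of_nonneg (mul_nonneg (hypTerm_nonneg k n) (by positivity))]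
    refine mul_le_mul (hypTerm_le k n) ?_ (by positivity) (by positivity)
    gcongr
    rw [div_le_iff₀ (by positivity)]
    nlinarith [mul_nonneg hk (n.cast_nonneg (α := ℝ))]

lemma tsum_hypTerm_zero :
    ∑' n : ℕ, hypFactor 0 * hypTerm 0 n * (8 * n + 6 * (0 : ℕ) + 1) =
      2 * Real.sqrt 3 / Real.pi := by
  have h := tendsto_hypFactor_mul.mul tendsto_tsum_hypTerm
  have hconst (k : ℕ) : hypFactor k * (k + 1 / 6) *
      ∑' n : ℕ, hypTerm k n * (8 * n / (k + 1 / 6) + 6) =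
      ∑' n : ℕ, hypFactor 0 * hypTerm 0 n * (8 * n + 6 * (0 : ℕ) + 1) := by
    rw [← tsum_hypTerm_eq k, ← tsum_mul_left]
    refine tsum_congr fun n => ?_
    field_simp
    ring
  simp_rw [hconst] at h
  rw [tendsto_nhds_unique tendsto_const_nhds h]
  have h3 : Real.sqrt 3 ^ 2 = 3 := Real.sq_sqrt (by norm_num)
  field_simp
  rw [h3]
  norm_num

lemma centralBinom_succ_cast (n : ℕ) :
    (Nat.centralBinom (n + 1) : ℝ) = 2 * (2 * n + 1) / (n + 1) * Nat.centralBinom n := by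
  have h : ((n : ℝ) + 1) * Nat.centralBinom (n + 1) = 2 * (2 * n + 1) * Nat.centralBinom n := by
    exact_mod_cast Nat.succ_mul_centralBinom_succ n
  field_simp
  linarith

lemma hypTerm_zero_eq_choose (k : ℕ) : hypTerm 0 k =
    (Nat.choose (4 * k) (2 * k) : ℝ) * (Nat.choose (2 * k) k : ℝ) ^ 2 /
      (2 ^ (8 * k) * 3 ^ (2 * k)) := by
  rw [show 4 * k = 2 * (2 * k) by ring, ← Nat.centralBinom_eq_two_mul_choose,
    ← Nat.centralBinom_eq_two_mul_choose]
  induction k with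
  | zero => simp [hypTerm_zero]
  | succ k ih =>
    rw [hypTerm_succ, ih, show 2 * (k + 1) = 2 * k + 1 + 1 by ring, centralBinom_succ_cast,
      centralBinom_succ_cast, centralBinom_succ_cast, show 8 * (k + 1) = 8 * k + 8 by ring,
      pow_add _ (8 * k), pow_succ _ (2 * k + 1), pow_succ _ (2 * k)]
    push_cast
    field_simp
    ring

/-- Ramanujan's formula for `1/π`. -/
theorem ramanujan_pi_formula :
    HasSum
      (fun k : ℕ =>
        (Nat.choose (4 * k) (2 * k) : ℝ) * (Nat.choose (2 * k) k : ℝ) ^ 2 /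
          (2 ^ (8 * k) * 3 ^ (2 * k)) * (8 * k + 1))
      (2 * Real.sqrt 3 / Real.pi) := by
  have h := (summable_hypTerm 0).hasSum
  rw [tsum_hypTerm_zero] at h
  simpa [hypFactor_zero, hypTerm_zero_eq_choose] using h
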